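/- arXiv:0906.1092 — 5 statements merged into one kernel-verified Lean document; each statement's English description precedes it below -/
import Mathlib

section
/- Let λ ∈ (0,1) and c_λ > 0. There exists a constant C > 0, depending only on λ, such that for every φ ∈ L¹(ℝ) ∩ BV(ℝ): ‖g_λ[φ]‖_{L¹(ℝ)} ≤ c_λ ∫_ℝ ∫_{ℝ\{0}} |φ(x+z) − φ(x)| / |z|^{1+λ} dz dx ≤ c_λ C ‖φ‖_{L¹(ℝ)}^{1−λ} |φ|_{BV(ℝ)}^{λ}. -/
open MeasureTheory Set Filter
open scoped ENNReal NNReal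

/-- The fractional Laplacian `g_λ = -(-∂_x²)^{λ/2}` acting on `φ : ℝ → ℝ`,
defined through the singular integral `c_λ ∫ (φ(x+z) - φ(x)) / |z|^{1+λ} dz`. -/
noncomputable def fracLap (lam clam : ℝ) (φ : ℝ → ℝ) (x : ℝ) : ℝ :=
  clam * ∫ z : ℝ, (φ (x + z) - φ x) / |z| ^ (1 + lam)

/-- The increments of `f` along a monotone two-sided sequence sum to at most its variation. -/
lemma eVariationOn.tsum_int_edist_le (f : ℝ → ℝ) {u : ℤ → ℝ} (hu : Monotone u) :
    ∑' n : ℤ, edist (f (u (n + 1))) (f (u n)) ≤ eVariationOn f univ := by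
  rw [ENNReal.tsum_eq_iSup_sum]
  refine iSup_le fun s => ?_
  obtain ⟨a, ha⟩ := s.bddBelow
  obtain ⟨b, hb⟩ := s.bddAbove
  have hsub : s ⊆ (Finset.range (b + 1 - a).toNat).image fun i : ℕ => a + (i : ℤ) := by
    intro n hn
    have h₁ : a ≤ n := ha hn
    have h₂ : n ≤ b := hb hn
    simp only [Finset.mem_image, Finset.mem_range]
    exact ⟨(n - a).toNat, by omega, by omega⟩
  refine (Finset.sum_le_sum_of_subset hsub).trans ?_
  rw [Finset.sum_image (fun i _ j _ h => by simpa using h)]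
  have hv : Monotone fun i : ℕ => u (a + (i : ℤ)) := fun i j hij => hu (by omega)
  simpa [add_assoc] using eVariationOn.sum_le (f := f) (s := univ)
    (n := (b + 1 - a).toNat) hv (fun _ => mem_univ _)

lemma BoundedVariationOn.measurable_of_univ {f : ℝ → ℝ} (hf : BoundedVariationOn f univ) :
    Measurable f := by
  obtain ⟨p, q, hp, hq, rfl⟩ :=
    hf.locallyBoundedVariationOn.exists_monotoneOn_sub_monotoneOn
  exact (monotoneOn_univ.1 hp).measurable.sub (monotoneOn_univ.1 hq).measurable

lemma lintegral_edist_add_right_le_of_pos {f : ℝ → ℝ} (hf : Measurable f) {h : ℝ} (hh : 0 < h) :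
    ∫⁻ x, edist (f (x + h)) (f x) ≤ ENNReal.ofReal h * eVariationOn f univ := by
  let e : ℤ ≃ AddSubgroup.zmultiples h :=
    Equiv.ofInjective (fun n : ℤ => n • h) (zsmul_left_strictMono hh).injective
  rw [(isAddFundamentalDomain_Ioc hh 0 volume).lintegral_eq_tsum''
      (fun x => edist (f (x + h)) (f x)),
    ← e.tsum_eq]
  have hm : ∀ n : ℤ, Measurable fun x : ℝ => edist (f (n • h + x + h)) (f (n • h + x)) :=
    fun n => by fun_prop
  change ∑' n : ℤ, ∫⁻ x in Ioc 0 (0 + h), edist (f (n • h + x + h)) (f (n • h + x)) ≤ _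
  rw [← lintegral_tsum fun n => (hm n).aemeasurable]
  calc ∫⁻ x in Ioc 0 (0 + h), ∑' n : ℤ, edist (f (n • h + x + h)) (f (n • h + x))
      ≤ ∫⁻ _ in Ioc 0 (0 + h), eVariationOn f univ := by
        refine lintegral_mono fun x => ?_
        have hu : Monotone fun n : ℤ => n • h + x := fun m n hmn => by
          have := zsmul_le_zsmul_left hh.le hmn
          simpa using this
        refine le_trans (le_of_eq (tsum_congr fun n => ?_))
          (eVariationOn.tsum_int_edist_le f hu)
        rw [add_smul, one_smul, add_right_comm]
    _ = ENNReal.ofReal h * eVariationOn f univ := by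
        simp [mul_comm]

/-- Translating a function by `h` moves it in `L¹` by at most `|h|` times its variation. -/
lemma lintegral_edist_add_right_le {f : ℝ → ℝ} (hf : Measurable f) (h : ℝ) :
    ∫⁻ x, edist (f (x + h)) (f x) ≤ ENNReal.ofReal |h| * eVariationOn f univ := by
  rcases lt_trichotomy h 0 with hh | rfl | hh
  · have := lintegral_edist_add_right_le_of_pos hf (neg_pos.2 hh)
    rw [← lintegral_add_right_eq_self _ h] at this
    simpa [edist_comm, abs_of_neg hh] using this
  · simp
  · simpa [abs_of_pos hh] using lintegral_edist_add_right_le_of_pos hf hh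

lemma lintegral_edist_add_right_le_two_mul {f : ℝ → ℝ} (hf : Measurable f) (h : ℝ) :
    ∫⁻ x, edist (f (x + h)) (f x) ≤ 2 * ∫⁻ x, ‖f x‖ₑ := by
  calc ∫⁻ x, edist (f (x + h)) (f x) ≤ ∫⁻ x, (‖f (x + h)‖ₑ + ‖f x‖ₑ) := by
        refine lintegral_mono fun x => ?_
        rw [edist_eq_enorm_sub]
        exact enorm_sub_le
    _ = 2 * ∫⁻ x, ‖f x‖ₑ := by
        rw [lintegral_add_right _ hf.enorm, lintegral_add_right_eq_self (fun x => ‖f x‖ₑ) h,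
          two_mul]

lemma lintegral_comp_abs (f : ℝ → ℝ≥0∞) :
    ∫⁻ x, f |x| = 2 * ∫⁻ x in Ioi (0 : ℝ), f x := by
  have hpos : ∫⁻ x in Ioi (0 : ℝ), f |x| = ∫⁻ x in Ioi (0 : ℝ), f x :=
    setLIntegral_congr_fun measurableSet_Ioi fun x hx => by
      simp only [abs_of_pos (mem_Ioi.1 hx)]
  have hneg : ∫⁻ x in Iic (0 : ℝ), f |x| = ∫⁻ x in Ioi (0 : ℝ), f |x| := by
    have := (Measure.measurePreserving_neg (volume : Measure ℝ)).setLIntegral_comp_preimage_emb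
      (Homeomorph.neg ℝ).measurableEmbedding (fun x => f |x|) (Iic 0)
    rw [← this]
    simp [setLIntegral_congr Ioi_ae_eq_Ici]
  rw [← lintegral_add_compl _ (measurableSet_Iic (a := (0 : ℝ))), compl_Iic, hneg, hpos, two_mul]

/-- The singular kernel integrated against the interpolation weight `min B (A t)`. -/
lemma setLIntegral_min_div_rpow_le {lam A B : ℝ} (hlam : lam ∈ Ioo (0 : ℝ) 1)
    (hA : 0 < A) (hB : 0 < B) :
    ∫⁻ t in Ioi (0 : ℝ), ENNReal.ofReal (min B (A * t) / t ^ (1 + lam)) ≤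
      ENNReal.ofReal ((1 / (1 - lam) + 1 / lam) * (B ^ (1 - lam) * A ^ lam)) := by
  obtain ⟨h0, h1⟩ := hlam
  set r := B / A with hr
  have hr0 : 0 < r := div_pos hB hA
  have hint₁ : IntegrableOn (fun t : ℝ => A * t ^ (-lam)) (Ioc 0 r) :=
    ((intervalIntegrable_iff_integrableOn_Ioc_of_le hr0.le).1
      (intervalIntegral.intervalIntegrable_rpow' (by linarith))).const_mul A
  have hint₂ : IntegrableOn (fun t : ℝ => B * t ^ (-(1 + lam))) (Ioi r) :=
    (integrableOn_Ioi_rpow_of_lt (by linarith) hr0).const_mul B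
  have hval₁ : ∫ t in Ioc 0 r, A * t ^ (-lam) = 1 / (1 - lam) * (B ^ (1 - lam) * A ^ lam) := by
    rw [integral_const_mul, ← intervalIntegral.integral_of_le hr0.le,
      integral_rpow (Or.inl (by linarith)), Real.zero_rpow (by linarith), hr,
      Real.div_rpow hB.le hA.le, show -lam + 1 = 1 - lam by ring, Real.rpow_sub hA, Real.rpow_one]
    field_simp
    ring
  have hval₂ : ∫ t in Ioi r, B * t ^ (-(1 + lam)) = 1 / lam * (B ^ (1 - lam) * A ^ lam) := by
    rw [integral_const_mul, integral_Ioi_rpow_of_lt (by linarith) hr0, hr,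
      show -(1 + lam) + 1 = -lam by ring, Real.div_rpow hB.le hA.le, Real.rpow_neg hB.le,
      Real.rpow_neg hA.le, Real.rpow_sub hB, Real.rpow_one]
    field_simp
  have hle₁ : ∫⁻ t in Ioc 0 r, ENNReal.ofReal (min B (A * t) / t ^ (1 + lam)) ≤
      ENNReal.ofReal (1 / (1 - lam) * (B ^ (1 - lam) * A ^ lam)) := by
    rw [← hval₁, ofReal_integral_eq_lintegral_ofReal hint₁
      ((ae_restrict_mem measurableSet_Ioc).mono fun t ht =>
        mul_nonneg hA.le (Real.rpow_nonneg ht.1.le _))]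
    refine setLIntegral_mono' measurableSet_Ioc fun t ht => ENNReal.ofReal_le_ofReal ?_
    have ht0 : 0 < t := ht.1
    rw [div_le_iff₀ (Real.rpow_pos_of_pos ht0 _), mul_assoc, ← Real.rpow_add ht0]
    simp
  have hle₂ : ∫⁻ t in Ioi r, ENNReal.ofReal (min B (A * t) / t ^ (1 + lam)) ≤
      ENNReal.ofReal (1 / lam * (B ^ (1 - lam) * A ^ lam)) := by
    rw [← hval₂, ofReal_integral_eq_lintegral_ofReal hint₂
      ((ae_restrict_mem measurableSet_Ioi).mono fun t ht =>
        mul_nonneg hB.le (Real.rpow_nonneg (hr0.trans ht).le _))]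
    refine setLIntegral_mono' measurableSet_Ioi fun t ht => ENNReal.ofReal_le_ofReal ?_
    have ht0 : 0 < t := hr0.trans ht
    rw [div_le_iff₀ (Real.rpow_pos_of_pos ht0 _), mul_assoc, ← Real.rpow_add ht0]
    simp
  have h1' : 0 < 1 - lam := by linarith
  rw [add_mul, ENNReal.ofReal_add (by positivity) (by positivity), ← Ioc_union_Ioi_eq_Ioi hr0.le]
  exact (lintegral_union_le _ _ _).trans (add_le_add hle₁ hle₂)

lemma lintegral_mul_kernel_le {lam A B : ℝ} (hlam : lam ∈ Ioo (0 : ℝ) 1) (hA : 0 ≤ A)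
    (hB : 0 ≤ B) {D : ℝ → ℝ≥0∞} (hDA : ∀ z, D z ≤ ENNReal.ofReal (A * |z|))
    (hDB : ∀ z, D z ≤ ENNReal.ofReal B) :
    ∫⁻ z, D z * ENNReal.ofReal (1 / |z| ^ (1 + lam)) ≤
      ENNReal.ofReal (2 * (1 / (1 - lam) + 1 / lam) * (B ^ (1 - lam) * A ^ lam)) := by
  rcases hA.eq_or_lt with rfl | hA
  · have hD : ∀ z, D z = 0 := fun z => by simpa using hDA z
    simp [hD]
  rcases hB.eq_or_lt with rfl | hB
  · have hD : ∀ z, D z = 0 := fun z => by simpa using hDB z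
    simp [hD]
  calc ∫⁻ z, D z * ENNReal.ofReal (1 / |z| ^ (1 + lam))
      ≤ ∫⁻ z : ℝ, ENNReal.ofReal (min B (A * |z|) / |z| ^ (1 + lam)) := by
        refine lintegral_mono fun z => ?_
        rw [div_eq_mul_one_div (min B _), ENNReal.ofReal_mul (by positivity)]
        gcongr
        rw [ENNReal.ofReal_min]
        exact le_min (hDB z) (hDA z)
    _ = 2 * ∫⁻ t in Ioi (0 : ℝ), ENNReal.ofReal (min B (A * t) / t ^ (1 + lam)) :=
        lintegral_comp_abs fun t => ENNReal.ofReal (min B (A * t) / t ^ (1 + lam))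
    _ ≤ 2 * ENNReal.ofReal ((1 / (1 - lam) + 1 / lam) * (B ^ (1 - lam) * A ^ lam)) := by
        gcongr
        exact setLIntegral_min_div_rpow_le hlam hA hB
    _ = _ := by
        rw [mul_assoc 2, ENNReal.ofReal_mul zero_le_two, ENNReal.ofReal_ofNat]

/-- The Gagliardo double integral of an `L¹ ∩ BV` function, by interpolation. -/
lemma lintegral_prod_gagliardo_le {lam : ℝ} (hlam : lam ∈ Ioo (0 : ℝ) 1) {φ : ℝ → ℝ}
    (hφ : Integrable φ) (hbv : BoundedVariationOn φ univ) :
    ∫⁻ p : ℝ × ℝ, ENNReal.ofReal (|φ (p.1 + p.2) - φ p.1| / |p.2| ^ (1 + lam)) ≤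
      ENNReal.ofReal (2 * (1 / (1 - lam) + 1 / lam) *
        ((2 * ∫ x, |φ x|) ^ (1 - lam) * (eVariationOn φ univ).toReal ^ lam)) := by
  have hm : Measurable φ := hbv.measurable_of_univ
  have hN : 0 ≤ ∫ x, |φ x| := integral_nonneg fun x => abs_nonneg _
  rw [Measure.volume_eq_prod, lintegral_prod_symm' _ (by fun_prop)]
  have hinner : ∀ z : ℝ, ∫⁻ x, ENNReal.ofReal (|φ (x + z) - φ x| / |z| ^ (1 + lam)) =
      (∫⁻ x, edist (φ (x + z)) (φ x)) * ENNReal.ofReal (1 / |z| ^ (1 + lam)) := fun z => by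
    rw [← lintegral_mul_const _ (by fun_prop)]
    refine lintegral_congr fun x => ?_
    rw [div_eq_mul_one_div, ENNReal.ofReal_mul (abs_nonneg _), edist_dist, Real.dist_eq]
  simp only [hinner]
  refine lintegral_mul_kernel_le hlam ENNReal.toReal_nonneg (by positivity) (fun z => ?_)
    fun z => ?_
  · refine (lintegral_edist_add_right_le hm z).trans_eq ?_
    rw [ENNReal.ofReal_mul ENNReal.toReal_nonneg, ENNReal.ofReal_toReal hbv, mul_comm]
  · refine (lintegral_edist_add_right_le_two_mul hm z).trans_eq ?_
    rw [ENNReal.ofReal_mul zero_le_two, ENNReal.ofReal_ofNat,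
      ← ofReal_integral_norm_eq_lintegral_enorm hφ]
    rfl

/-- Lemma A.1: `‖g_λ[φ]‖_{L¹} ≤ c_λ ∫∫ |φ(x+z)−φ(x)|/|z|^{1+λ} ≤ c_λ C ‖φ‖_{L¹}^{1−λ} |φ|_{BV}^λ`,
with `C` depending only on `λ`. -/
theorem stmt_0 (lam : ℝ) (hlam : lam ∈ Set.Ioo (0 : ℝ) 1) :
    ∃ C > (0 : ℝ), ∀ clam > (0 : ℝ), ∀ φ : ℝ → ℝ,
      Integrable φ → BoundedVariationOn φ Set.univ →
      ((∫ x : ℝ, |fracLap lam clam φ x|) ≤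
          clam * ∫ x : ℝ, ∫ z : ℝ, |φ (x + z) - φ x| / |z| ^ (1 + lam)) ∧
      clam * (∫ x : ℝ, ∫ z : ℝ, |φ (x + z) - φ x| / |z| ^ (1 + lam)) ≤
          clam * C * (∫ x : ℝ, |φ x|) ^ (1 - lam) *
            (eVariationOn φ Set.univ).toReal ^ lam := by
  have h0 : 0 < lam := hlam.1
  have h1 : 0 < 1 - lam := sub_pos.2 hlam.2
  refine ⟨2 * (1 / (1 - lam) + 1 / lam) * 2 ^ (1 - lam), by positivity, ?_⟩
  intro clam hclam φ hφ hbv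
  have hm : Measurable φ := hbv.measurable_of_univ
  have hN : 0 ≤ ∫ x, |φ x| := integral_nonneg fun x => abs_nonneg _
  have hle := lintegral_prod_gagliardo_le hlam hφ hbv
  set F : ℝ × ℝ → ℝ := fun p => |φ (p.1 + p.2) - φ p.1| / |p.2| ^ (1 + lam) with hF
  have hF0 : ∀ p, 0 ≤ F p := fun p => by positivity
  have hFm : Measurable F := by fun_prop
  have hFint : Integrable F (volume.prod volume) :=
    ⟨hFm.aestronglyMeasurable, (hasFiniteIntegral_iff_ofReal (ae_of_all _ hF0)).2
      (hle.trans_lt ENNReal.ofReal_lt_top)⟩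
  refine ⟨?_, ?_⟩
  · rw [← integral_const_mul]
    refine integral_mono_of_nonneg (ae_of_all _ fun x => abs_nonneg _)
      (hFint.integral_prod_left.const_mul clam) (ae_of_all _ fun x => ?_)
    simp only [fracLap, abs_mul, abs_of_pos hclam]
    gcongr
    refine (abs_integral_le_integral_abs).trans_eq (integral_congr_ae (ae_of_all _ fun z => ?_))
    simp only [abs_div, abs_of_nonneg (Real.rpow_nonneg (abs_nonneg z) (1 + lam))]
  · have hprod : ∫ x, ∫ z, F (x, z) = ∫ p, F p := (integral_prod F hFint).symm
    have hval : ∫ p, F p ≤ 2 * (1 / (1 - lam) + 1 / lam) *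
        ((2 * ∫ x, |φ x|) ^ (1 - lam) * (eVariationOn φ univ).toReal ^ lam) := by
      rw [integral_eq_lintegral_of_nonneg_ae (ae_of_all _ hF0) hFm.aestronglyMeasurable]
      exact ENNReal.toReal_le_of_le_ofReal (by positivity) hle
    rw [Real.mul_rpow zero_le_two hN, ← hprod] at hval
    refine (mul_le_mul_of_nonneg_left hval hclam.le).trans_eq ?_
    ring
end

section
/- Let λ ∈ (0,1), c_λ > 0 and Δx > 0. For every i ∈ ℤ the family (G^i_j)_{j∈ℤ} is absolutely summable, i.e. Σ_{j∈ℤ} |G^i_j| < ∞, and Σ_{j∈ℤ} G^i_j = 0. -/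
open MeasureTheory Set Filter
open scoped ENNReal NNReal

/-- The matrix entries `G^i_j = ∫_{I_i} g_λ[1_{I_j}] dx` on the grid of mesh `Δx`. -/
noncomputable def cellG (lam clam dx : ℝ) (i j : ℤ) : ℝ :=
  ∫ x in Set.Ioo ((i : ℝ) * dx) (((i : ℝ) + 1) * dx),
    fracLap lam clam
      (Set.indicator (Set.Ioo ((j : ℝ) * dx) (((j : ℝ) + 1) * dx)) fun _ => (1 : ℝ)) x

/-- The `j`-th open cell of the grid of mesh `dx`. -/
abbrev gridCell (dx : ℝ) (j : ℤ) : Set ℝ := Set.Ioo ((j : ℝ) * dx) (((j : ℝ) + 1) * dx)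

/-- The integrand of the singular integral defining `cellG`, as a function on the plane. -/
noncomputable def cellKernel (lam dx : ℝ) (j : ℤ) (p : ℝ × ℝ) : ℝ :=
  ((gridCell dx j).indicator (fun _ => (1 : ℝ)) (p.1 + p.2) -
    (gridCell dx j).indicator (fun _ => (1 : ℝ)) p.1) / |p.2| ^ (1 + lam)

theorem eq_floor_of_mem_gridCell {dx : ℝ} (hdx : 0 < dx) {y : ℝ} {j : ℤ}
    (hy : y ∈ gridCell dx j) : j = ⌊y / dx⌋ := by
  symm
  rw [Int.floor_eq_iff, le_div_iff₀ hdx, div_lt_iff₀ hdx]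
  exact ⟨hy.1.le, hy.2⟩

theorem mem_gridCell_floor {dx : ℝ} (hdx : 0 < dx) {y : ℝ}
    (hy : y ∉ Set.range fun k : ℤ => (k : ℝ) * dx) : y ∈ gridCell dx ⌊y / dx⌋ := by
  have h₁ := Int.floor_le (y / dx)
  have h₂ := Int.lt_floor_add_one (y / dx)
  rw [le_div_iff₀ hdx] at h₁
  rw [div_lt_iff₀ hdx] at h₂
  exact ⟨lt_of_le_of_ne h₁ fun h => hy ⟨_, h⟩, h₂⟩

theorem hasSum_indicator_gridCell {dx : ℝ} (hdx : 0 < dx) {y : ℝ} {i : ℤ}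
    (hy : y ∈ gridCell dx i) :
    HasSum (fun j : ℤ => (gridCell dx j).indicator (fun _ => (1 : ℝ)) y) 1 := by
  have h := hasSum_single (f := fun j : ℤ => (gridCell dx j).indicator (fun _ => (1 : ℝ)) y) i
    fun j hj => Set.indicator_of_notMem (fun hm => hj <| by
      rw [eq_floor_of_mem_gridCell hdx hm, eq_floor_of_mem_gridCell hdx hy]) _
  simpa only [Set.indicator_of_mem hy] using h

theorem tsum_enorm_indicator_gridCell_le {dx : ℝ} (hdx : 0 < dx) (y : ℝ) :
    ∑' j : ℤ, ‖(gridCell dx j).indicator (fun _ => (1 : ℝ)) y‖ₑ ≤ 1 := by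
  rw [tsum_eq_single ⌊y / dx⌋ fun j hj => by
    rw [Set.indicator_of_notMem fun hm => hj (eq_floor_of_mem_gridCell hdx hm), enorm_zero]]
  by_cases h : y ∈ gridCell dx ⌊y / dx⌋ <;> simp [h]

theorem indicator_gridCell_eq {dx : ℝ} (hdx : 0 < dx) {x y : ℝ} {i : ℤ}
    (hx : x ∈ gridCell dx i) (hy : y ∈ gridCell dx i) (j : ℤ) :
    (gridCell dx j).indicator (fun _ => (1 : ℝ)) y =
      (gridCell dx j).indicator (fun _ => (1 : ℝ)) x := by
  rcases eq_or_ne j i with rfl | hj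
  · rw [Set.indicator_of_mem hx, Set.indicator_of_mem hy]
  · have h : ∀ {w}, w ∈ gridCell dx i → w ∉ gridCell dx j := fun hw hm => hj <| by
      rw [eq_floor_of_mem_gridCell hdx hm, eq_floor_of_mem_gridCell hdx hw]
    rw [Set.indicator_of_notMem (h hx), Set.indicator_of_notMem (h hy)]

theorem measurable_cellKernel (lam dx : ℝ) (j : ℤ) : Measurable (cellKernel lam dx j) := by
  have h : Measurable ((gridCell dx j).indicator fun _ => (1 : ℝ)) :=
    measurable_const.indicator measurableSet_Ioo
  unfold cellKernel
  exact ((h.comp (measurable_fst.add measurable_snd)).sub (h.comp measurable_fst)).div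
    ((continuous_abs.measurable.comp measurable_snd).pow_const _)

theorem tsum_enorm_cellKernel_le {lam dx : ℝ} (hdx : 0 < dx) {i : ℤ} {x : ℝ}
    (hx : x ∈ gridCell dx i) (z : ℝ) :
    ∑' j : ℤ, ‖cellKernel lam dx j (x, z)‖ₑ ≤
      {p : ℝ × ℝ | p.1 + p.2 ∉ gridCell dx i}.indicator
        (fun p => 2 * ‖(|p.2| ^ (1 + lam))⁻¹‖ₑ) (x, z) := by
  by_cases h : x + z ∈ gridCell dx i
  · rw [Set.indicator_of_notMem (by simpa using h)]
    simp [cellKernel, indicator_gridCell_eq hdx hx h]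
  · rw [Set.indicator_of_mem (by simpa using h)]
    simp only [cellKernel, div_eq_mul_inv, enorm_mul]
    rw [ENNReal.tsum_mul_right]
    gcongr
    calc _ ≤ ∑' j : ℤ, (‖(gridCell dx j).indicator (fun _ => (1 : ℝ)) (x + z)‖ₑ +
          ‖(gridCell dx j).indicator (fun _ => (1 : ℝ)) x‖ₑ) :=
          ENNReal.tsum_le_tsum fun j => enorm_sub_le
      _ ≤ 1 + 1 := by
          rw [ENNReal.tsum_add]
          exact add_le_add (tsum_enorm_indicator_gridCell_le hdx _)
            (tsum_enorm_indicator_gridCell_le hdx _)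
      _ = 2 := one_add_one_eq_two

theorem volume_Ioo_diff_translate_le (a b z : ℝ) :
    volume {x | x ∈ Set.Ioo a b ∧ x + z ∉ Set.Ioo a b} ≤ ENNReal.ofReal (min |z| (b - a)) := by
  rw [ENNReal.ofReal_min]
  refine le_min ?_ ?_
  · rcases le_total 0 z with hz | hz
    · refine (measure_mono (t := Set.Ico (b - z) b) ?_).trans ?_
      · rintro x ⟨hx, hxz⟩
        refine ⟨?_, hx.2⟩
        by_contra! h
        exact hxz ⟨by linarith [hx.1], by linarith⟩
      · simp [abs_of_nonneg hz]
    · refine (measure_mono (t := Set.Ioc a (a - z)) ?_).trans ?_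
      · rintro x ⟨hx, hxz⟩
        refine ⟨hx.1, ?_⟩
        by_contra! h
        exact hxz ⟨by linarith, by linarith [hx.2]⟩
      · simp [abs_of_nonpos hz]
  · exact (measure_mono fun x hx => hx.1).trans Real.volume_Ioo.le

theorem integrable_inv_abs_rpow_mul_min {lam d : ℝ} (hlam : lam ∈ Set.Ioo (0 : ℝ) 1)
    (hd : 0 < d) : Integrable fun z : ℝ => (|z| ^ (1 + lam))⁻¹ * min |z| d := by
  have hpos : IntegrableOn (fun z : ℝ => (|z| ^ (1 + lam))⁻¹ * min |z| d) (Set.Ioi 0) := by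
    rw [← Set.Ioc_union_Ioi_eq_Ioi hd.le]
    refine IntegrableOn.union ?_ ?_
    · have h : IntegrableOn (fun z : ℝ => z ^ (-lam)) (Set.Ioc 0 d) :=
        (intervalIntegrable_iff_integrableOn_Ioc_of_le hd.le).1
          (intervalIntegral.intervalIntegrable_rpow' (by linarith [hlam.2]))
      refine h.congr_fun (fun z hz => ?_) measurableSet_Ioc
      have hz0 : 0 < z := hz.1
      simp only [abs_of_pos hz0, min_eq_left hz.2]
      rw [← Real.rpow_neg hz0.le, ← Real.rpow_add_one hz0.ne']
      congr 1
      ring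
    · have h : IntegrableOn (fun z : ℝ => z ^ (-(1 + lam)) * d) (Set.Ioi d) :=
        (integrableOn_Ioi_rpow_of_lt (by linarith [hlam.1]) hd).mul_const d
      refine h.congr_fun (fun z hz => ?_) measurableSet_Ioi
      have hz0 : 0 < z := hd.trans hz
      simp only [abs_of_pos hz0, min_eq_right (Set.mem_Ioi.1 hz).le]
      rw [← Real.rpow_neg hz0.le]
  have hneg : IntegrableOn (fun z : ℝ => (|z| ^ (1 + lam))⁻¹ * min |z| d) (Set.Iic 0) := by
    have m : MeasurableEmbedding (Neg.neg : ℝ → ℝ) := (Homeomorph.neg ℝ).measurableEmbedding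
    rw [← Measure.map_neg_eq_self (volume : Measure ℝ), m.integrableOn_map_iff]
    simpa [Function.comp_def] using (integrableOn_Ici_iff_integrableOn_Ioi enorm_ne_top).2 hpos
  rw [← integrableOn_univ, ← Set.Iic_union_Ioi (a := (0 : ℝ))]
  exact hneg.union hpos

theorem tsum_lintegral_enorm_cellKernel_ne_top {lam dx : ℝ} (hlam : lam ∈ Set.Ioo (0 : ℝ) 1)
    (hdx : 0 < dx) (i : ℤ) :
    ∑' j : ℤ, ∫⁻ p, ‖cellKernel lam dx j p‖ₑ ∂((volume.restrict (gridCell dx i)).prod volume)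
      ≠ ∞ := by
  have hK : Measurable fun z : ℝ => ‖(|z| ^ (1 + lam))⁻¹‖ₑ :=
    (continuous_abs.measurable.pow_const _).inv.enorm
  have hS : MeasurableSet {p : ℝ × ℝ | p.1 + p.2 ∉ gridCell dx i} :=
    (measurable_fst.add measurable_snd) measurableSet_Ioo.compl
  have hB : Measurable ({p : ℝ × ℝ | p.1 + p.2 ∉ gridCell dx i}.indicator
      fun p => 2 * ‖(|p.2| ^ (1 + lam))⁻¹‖ₑ) :=
    ((hK.comp measurable_snd).const_mul 2).indicator hS
  have hT := ((integrable_inv_abs_rpow_mul_min hlam hdx).hasFiniteIntegral)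
  rw [← lintegral_tsum fun j => (measurable_cellKernel lam dx j).enorm.aemeasurable]
  refine ne_of_lt ?_
  calc _ = ∫⁻ x in gridCell dx i, ∫⁻ z, ∑' j : ℤ, ‖cellKernel lam dx j (x, z)‖ₑ := by
        rw [lintegral_prod _
          (Measurable.tsum fun j => (measurable_cellKernel lam dx j).enorm).aemeasurable]
    _ ≤ ∫⁻ x in gridCell dx i, ∫⁻ z, {p : ℝ × ℝ | p.1 + p.2 ∉ gridCell dx i}.indicator
        (fun p => 2 * ‖(|p.2| ^ (1 + lam))⁻¹‖ₑ) (x, z) :=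
        setLIntegral_mono' measurableSet_Ioo fun x hx =>
          lintegral_mono fun z => tsum_enorm_cellKernel_le hdx hx z
    _ = ∫⁻ z, ∫⁻ x in gridCell dx i, {p : ℝ × ℝ | p.1 + p.2 ∉ gridCell dx i}.indicator
        (fun p => 2 * ‖(|p.2| ^ (1 + lam))⁻¹‖ₑ) (x, z) :=
        lintegral_lintegral_swap hB.aemeasurable
    _ ≤ ∫⁻ z, 2 * ‖(|z| ^ (1 + lam))⁻¹ * min |z| dx‖ₑ := by
        refine lintegral_mono fun z => ?_
        have hSz : MeasurableSet {x : ℝ | x + z ∉ gridCell dx i} :=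
          (measurable_id.add_const z) measurableSet_Ioo.compl
        calc _ = ∫⁻ x in gridCell dx i, {x : ℝ | x + z ∉ gridCell dx i}.indicator
              (fun _ => 2 * ‖(|z| ^ (1 + lam))⁻¹‖ₑ) x := rfl
          _ = 2 * ‖(|z| ^ (1 + lam))⁻¹‖ₑ *
              volume {x | x ∈ gridCell dx i ∧ x + z ∉ gridCell dx i} := by
              rw [lintegral_indicator_const hSz, Measure.restrict_apply hSz, Set.inter_comm]
              rfl
          _ ≤ 2 * ‖(|z| ^ (1 + lam))⁻¹‖ₑ * ‖min |z| dx‖ₑ := by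
              gcongr
              refine (volume_Ioo_diff_translate_le _ _ z).trans_eq ?_
              rw [Real.enorm_of_nonneg (le_min (abs_nonneg z) hdx.le)]
              ring_nf
          _ = _ := by rw [enorm_mul, mul_assoc]
    _ < ∞ := by
        rw [lintegral_const_mul' _ _ (by simp)]
        exact ENNReal.mul_lt_top (by simp) hT

theorem tsum_cellKernel_eq_zero {lam dx : ℝ} (hdx : 0 < dx) {p : ℝ × ℝ} {i k : ℤ}
    (hx : p.1 ∈ gridCell dx i) (hy : p.1 + p.2 ∈ gridCell dx k) :
    ∑' j : ℤ, cellKernel lam dx j p = 0 := by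
  have h := ((hasSum_indicator_gridCell hdx hy).sub (hasSum_indicator_gridCell hdx hx)).div_const
    (|p.2| ^ (1 + lam))
  rw [sub_self, zero_div] at h
  exact h.tsum_eq

theorem ae_tsum_cellKernel_eq_zero (lam : ℝ) {dx : ℝ} (hdx : 0 < dx) (i : ℤ) :
    ∀ᵐ p ∂((volume.restrict (gridCell dx i)).prod volume),
      ∑' j : ℤ, cellKernel lam dx j p = 0 := by
  have hgrid : (Set.range fun k : ℤ => (k : ℝ) * dx).Countable := Set.countable_range _
  have hmeas : MeasurableSet {p : ℝ × ℝ | p.1 ∈ gridCell dx i ∧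
      p.1 + p.2 ∈ (Set.range fun k : ℤ => (k : ℝ) * dx)ᶜ} :=
    (measurable_fst measurableSet_Ioo).inter
      ((measurable_fst.add measurable_snd) hgrid.measurableSet.compl)
  have h : ∀ᵐ p ∂((volume.restrict (gridCell dx i)).prod volume),
      p.1 ∈ gridCell dx i ∧ p.1 + p.2 ∈ (Set.range fun k : ℤ => (k : ℝ) * dx)ᶜ := by
    rw [Measure.ae_prod_iff_ae_ae hmeas]
    filter_upwards [ae_restrict_mem measurableSet_Ioo] with x hx
    have hz : ∀ᵐ z : ℝ, x + z ∈ (Set.range fun k : ℤ => (k : ℝ) * dx)ᶜ :=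
      (measurePreserving_add_left volume x).quasiMeasurePreserving.ae
        (hgrid.ae_notMem volume)
    filter_upwards [hz] with z hz using ⟨hx, hz⟩
  filter_upwards [h] with p hp
  exact tsum_cellKernel_eq_zero hdx hp.1 (mem_gridCell_floor hdx hp.2)

theorem hasSum_cellG (clam : ℝ) {lam dx : ℝ} (hlam : lam ∈ Set.Ioo (0 : ℝ) 1) (hdx : 0 < dx)
    (i : ℤ) : HasSum (fun j : ℤ => cellG lam clam dx i j) 0 := by
  set μ : Measure (ℝ × ℝ) := (volume.restrict (gridCell dx i)).prod volume
  have hfin := tsum_lintegral_enorm_cellKernel_ne_top hlam hdx i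
  have hint : ∀ j, Integrable (cellKernel lam dx j) μ := fun j =>
    ⟨(measurable_cellKernel lam dx j).aestronglyMeasurable,
      (ENNReal.ne_top_of_tsum_ne_top hfin j).lt_top⟩
  have hsum : Summable fun j : ℤ => ∫ p, ‖cellKernel lam dx j p‖ ∂μ := by
    simp_rw [integral_norm_eq_lintegral_enorm (hint _).aestronglyMeasurable]
    exact ENNReal.summable_toReal hfin
  have h := (hasSum_integral_of_summable_integral_norm hint hsum).mul_left clam
  rw [integral_eq_zero_of_ae (ae_tsum_cellKernel_eq_zero lam hdx i), mul_zero] at h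
  refine h.congr_fun fun j => ?_
  rw [integral_prod _ (hint j), ← integral_const_mul]
  rfl

/-- Proposition 4.1 (summability): for each `i`, the family `(G^i_j)_j` is absolutely
summable and `Σ_j G^i_j = 0`. -/
theorem stmt_3 (lam clam dx : ℝ) (hlam : lam ∈ Set.Ioo (0 : ℝ) 1) (hclam : 0 < clam)
    (hdx : 0 < dx) (i : ℤ) :
    Summable (fun j : ℤ => |cellG lam clam dx i j|) ∧
    ∑' j : ℤ, cellG lam clam dx i j = 0 := by
  have h := hasSum_cellG clam hlam hdx i
  exact ⟨h.summable.abs, h.tsum_eq⟩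
end

section
/- Let λ ∈ (0,1), c_λ > 0 and Δx > 0. Then G^i_j ≥ 0 whenever i ≠ j, while for every i ∈ ℤ the diagonal entry equals G^i_i = −d_λ Δx^{1−λ}, where d_λ := c_λ (∫_{|z|<1} |z|^{−λ} dz + ∫_{|z|>1} |z|^{−1−λ} dz) > 0. -/
open MeasureTheory Set Filter
open scoped ENNReal NNReal

/-- The constant `d_λ = c_λ (∫_{|z|<1} |z|^{-λ} dz + ∫_{|z|>1} |z|^{-1-λ} dz)`. -/
noncomputable def dlam (lam clam : ℝ) : ℝ :=
  clam * ((∫ z in {z : ℝ | |z| < 1}, |z| ^ (-lam)) + ∫ z in {z : ℝ | 1 < |z|}, |z| ^ (-(1 + lam)))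

theorem integrableOn_Ioi_inv_abs_rpow {lam c : ℝ} (hlam : 0 < lam) (hc : 0 < c) :
    IntegrableOn (fun z : ℝ => (|z| ^ (1 + lam))⁻¹) (Ioi c) := by
  refine (integrableOn_Ioi_rpow_of_lt (a := -(1 + lam)) (by linarith) hc).congr_fun
    (fun z hz => ?_) measurableSet_Ioi
  have hz0 : 0 < z := hc.trans hz
  simp only [abs_of_pos hz0, Real.rpow_neg hz0.le]

theorem integral_Ioi_inv_abs_rpow {lam c : ℝ} (hlam : 0 < lam) (hc : 0 < c) :
    ∫ z in Ioi c, (|z| ^ (1 + lam))⁻¹ = c ^ (-lam) / lam := by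
  have h : ∫ z in Ioi c, (|z| ^ (1 + lam))⁻¹ = ∫ z in Ioi c, z ^ (-(1 + lam)) := by
    refine setIntegral_congr_fun measurableSet_Ioi fun z hz => ?_
    have hz0 : 0 < z := hc.trans hz
    simp only [abs_of_pos hz0, Real.rpow_neg hz0.le]
  rw [h, integral_Ioi_rpow_of_lt (by linarith) hc]
  rw [show -(1 + lam) + 1 = -lam by ring, neg_div_neg_eq]

theorem integrableOn_Iic_inv_abs_rpow {lam c : ℝ} (hlam : 0 < lam) (hc : 0 < c) :
    IntegrableOn (fun z : ℝ => (|z| ^ (1 + lam))⁻¹) (Iic (-c)) := by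
  have h := (integrableOn_Ioi_inv_abs_rpow hlam hc)
  rw [← integrableOn_Ici_iff_integrableOn_Ioi] at h
  have h' := (Measure.measurePreserving_neg (volume : Measure ℝ)).integrableOn_comp_preimage
    (Homeomorph.neg ℝ).measurableEmbedding |>.2 h
  simpa [Function.comp_def] using h'

theorem integral_Iic_inv_abs_rpow {lam c : ℝ} (hlam : 0 < lam) (hc : 0 < c) :
    ∫ z in Iic (-c), (|z| ^ (1 + lam))⁻¹ = c ^ (-lam) / lam := by
  have h := integral_comp_neg_Iic (-c) fun z : ℝ => (|z| ^ (1 + lam))⁻¹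
  simp only [abs_neg, neg_neg] at h
  rw [h, integral_Ioi_inv_abs_rpow hlam hc]

/-- On its own cell, the fractional Laplacian of an indicator is minus the mass of the two
tails of the kernel. -/
theorem fracLap_indicator_Ioo_of_mem {lam clam a b x : ℝ} (hlam : 0 < lam) (hx : x ∈ Ioo a b) :
    fracLap lam clam (indicator (Ioo a b) fun _ => (1 : ℝ)) x
      = -(clam / lam) * ((x - a) ^ (-lam) + (b - x) ^ (-lam)) := by
  have ha : 0 < x - a := sub_pos.2 hx.1
  have hb : 0 < b - x := sub_pos.2 hx.2
  have hI := (integrableOn_Iic_inv_abs_rpow hlam ha)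
  have hJ := (integrableOn_Ici_iff_integrableOn_Ioi (μ := volume)).2
    (integrableOn_Ioi_inv_abs_rpow hlam hb)
  have key : ∀ z : ℝ,
      (indicator (Ioo a b) (fun _ => (1 : ℝ)) (x + z) - indicator (Ioo a b) (fun _ => (1 : ℝ)) x)
          / |z| ^ (1 + lam)
        = -(indicator (Iic (-(x - a))) (fun z : ℝ => (|z| ^ (1 + lam))⁻¹) z
          + indicator (Ici (b - x)) (fun z : ℝ => (|z| ^ (1 + lam))⁻¹) z) := by
    intro z
    rw [indicator_of_mem hx]
    by_cases h1 : z ≤ -(x - a)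
    · have h2 : z ∉ Ici (b - x) := fun h => by have := mem_Ici.1 h; linarith
      have h3 : x + z ∉ Ioo a b := fun h => by linarith [h.1]
      rw [indicator_of_mem (mem_Iic.2 h1), indicator_of_notMem h2, indicator_of_notMem h3]
      ring
    · have h1' : z ∉ Iic (-(x - a)) := h1
      rw [indicator_of_notMem h1']
      by_cases h2 : b - x ≤ z
      · have h3 : x + z ∉ Ioo a b := fun h => by linarith [h.2]
        rw [indicator_of_mem (mem_Ici.2 h2), indicator_of_notMem h3]
        ring
      · have h2' : z ∉ Ici (b - x) := h2
        have h3 : x + z ∈ Ioo a b := ⟨by linarith, by linarith⟩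
        rw [indicator_of_notMem h2', indicator_of_mem h3]
        simp
  unfold fracLap
  simp only [key]
  rw [integral_neg, integral_add (hI.integrable_indicator measurableSet_Iic)
    (hJ.integrable_indicator measurableSet_Ici), integral_indicator measurableSet_Iic,
    integral_indicator measurableSet_Ici, integral_Ici_eq_integral_Ioi,
    integral_Iic_inv_abs_rpow hlam ha, integral_Ioi_inv_abs_rpow hlam hb]
  ring

theorem fracLap_indicator_nonneg_of_notMem {lam clam x : ℝ} {s : Set ℝ} (hclam : 0 ≤ clam)
    (hx : x ∉ s) : 0 ≤ fracLap lam clam (indicator s fun _ => (1 : ℝ)) x := by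
  refine mul_nonneg hclam (integral_nonneg fun z => ?_)
  rw [indicator_of_notMem hx, sub_zero]
  exact div_nonneg (indicator_nonneg (fun _ _ => zero_le_one) _) (by positivity)

theorem dlam_eq {lam : ℝ} (clam : ℝ) (hlam : lam ∈ Ioo (0 : ℝ) 1) :
    dlam lam clam = 2 * clam / (lam * (1 - lam)) := by
  obtain ⟨h0, h1⟩ := hlam
  have hin : ∫ z in {z : ℝ | |z| < 1}, |z| ^ (-lam) = 2 / (1 - lam) := by
    rw [← integral_indicator (measurableSet_lt continuous_abs.measurable measurable_const)]
    have h := integral_comp_abs (f := indicator (Iio 1) fun z : ℝ => z ^ (-lam))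
    have e : (∫ z : ℝ, indicator {z : ℝ | |z| < 1} (fun z => |z| ^ (-lam)) z)
        = ∫ z : ℝ, indicator (Iio 1) (fun z : ℝ => z ^ (-lam)) |z| := rfl
    rw [e, h, setIntegral_indicator measurableSet_Iio, Ioi_inter_Iio,
      ← integral_Ioc_eq_integral_Ioo, ← intervalIntegral.integral_of_le zero_le_one,
      integral_rpow (Or.inl (by linarith)), Real.one_rpow, Real.zero_rpow (by linarith)]
    ring
  have hout : ∫ z in {z : ℝ | 1 < |z|}, |z| ^ (-(1 + lam)) = 2 / lam := by
    rw [← integral_indicator (measurableSet_lt measurable_const continuous_abs.measurable)]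
    have h := integral_comp_abs (f := indicator (Ioi 1) fun z : ℝ => z ^ (-(1 + lam)))
    have e : (∫ z : ℝ, indicator {z : ℝ | 1 < |z|} (fun z => |z| ^ (-(1 + lam))) z)
        = ∫ z : ℝ, indicator (Ioi 1) (fun z : ℝ => z ^ (-(1 + lam))) |z| := rfl
    rw [e, h, setIntegral_indicator measurableSet_Ioi, Ioi_inter_Ioi, sup_of_le_right zero_le_one,
      integral_Ioi_rpow_of_lt (by linarith) one_pos, Real.one_rpow,
      show -(1 + lam) + 1 = -lam by ring, neg_div_neg_eq]
    ring
  have h1' : 1 - lam ≠ 0 := by linarith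
  rw [dlam, hin, hout]
  field_simp
  ring

theorem integral_rpow_neg_sub_add {lam a d : ℝ} (hlam : lam < 1) (hd : 0 < d) :
    ∫ x in Ioo a (a + d), ((x - a) ^ (-lam) + (a + d - x) ^ (-lam))
      = 2 * d ^ (1 - lam) / (1 - lam) := by
  have hint : IntervalIntegrable (fun x : ℝ => x ^ (-lam)) volume 0 d :=
    intervalIntegral.intervalIntegrable_rpow' (by linarith)
  have hl : IntervalIntegrable (fun x : ℝ => (x - a) ^ (-lam)) volume a (a + d) := by
    simpa [add_comm] using hint.comp_sub_right a
  have hr : IntervalIntegrable (fun x : ℝ => (a + d - x) ^ (-lam)) volume a (a + d) := by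
    simpa using (hint.comp_sub_left (a + d)).symm
  have hv : ∫ x in (0 : ℝ)..d, x ^ (-lam) = d ^ (1 - lam) / (1 - lam) := by
    rw [integral_rpow (Or.inl (by linarith)), Real.zero_rpow (by linarith),
      show -lam + 1 = 1 - lam by ring, sub_zero]
  rw [← integral_Ioc_eq_integral_Ioo, ← intervalIntegral.integral_of_le (by linarith),
    intervalIntegral.integral_add hl hr,
    intervalIntegral.integral_comp_sub_right (fun x : ℝ => x ^ (-lam)) a,
    intervalIntegral.integral_comp_sub_left (fun x : ℝ => x ^ (-lam)) (a + d),
    sub_self, sub_self, add_sub_cancel_left, hv]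
  ring

theorem disjoint_Ioo_int_mul {dx : ℝ} (hdx : 0 < dx) {i j : ℤ} (hij : i ≠ j) :
    Disjoint (Ioo ((i : ℝ) * dx) (((i : ℝ) + 1) * dx))
      (Ioo ((j : ℝ) * dx) (((j : ℝ) + 1) * dx)) := by
  refine Set.disjoint_left.2 fun x hi hj => hij ?_
  have h1 : (i : ℝ) < j + 1 := lt_of_mul_lt_mul_right (hi.1.trans hj.2) hdx.le
  have h2 : (j : ℝ) < i + 1 := lt_of_mul_lt_mul_right (hj.1.trans hi.2) hdx.le
  norm_cast at h1 h2
  lia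

/-- Proposition 4.1 (signs and diagonal): `G^i_j ≥ 0` for `i ≠ j`, `d_λ > 0`, and
`G^i_i = −d_λ Δx^{1−λ}`. -/
theorem stmt_5 (lam clam dx : ℝ) (hlam : lam ∈ Set.Ioo (0 : ℝ) 1) (hclam : 0 < clam)
    (hdx : 0 < dx) :
    (∀ i j : ℤ, i ≠ j → 0 ≤ cellG lam clam dx i j) ∧
    0 < dlam lam clam ∧
    ∀ i : ℤ, cellG lam clam dx i i = -(dlam lam clam) * dx ^ (1 - lam) := by
  refine ⟨fun i j hij => ?_, ?_, fun i => ?_⟩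
  · exact setIntegral_nonneg measurableSet_Ioo fun x hx =>
      fracLap_indicator_nonneg_of_notMem hclam.le
        (Set.disjoint_left.1 (disjoint_Ioo_int_mul hdx hij) hx)
  · rw [dlam_eq clam hlam]
    have := hlam.1
    have : 0 < 1 - lam := sub_pos.2 hlam.2
    positivity
  · have h1 : 1 - lam ≠ 0 := (sub_pos.2 hlam.2).ne'
    have h0 : lam ≠ 0 := hlam.1.ne'
    rw [cellG, setIntegral_congr_fun measurableSet_Ioo
      fun x hx => fracLap_indicator_Ioo_of_mem hlam.1 hx, integral_const_mul,
      show ((i : ℝ) + 1) * dx = i * dx + dx by ring,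
      integral_rpow_neg_sub_add hlam.2 hdx, dlam_eq clam hlam]
    field_simp
end

section
/- Let λ ∈ (0,1), k ∈ ℕ, Δx ∈ (0,1], and let v: ℝ → ℝ be measurable and continuously differentiable on each open cell I_i = (iΔx, (i+1)Δx). Suppose there are nonnegative reals (A_i)_{i∈ℤ} with M := Σ_{i∈ℤ} A_i < ∞ such that for every i ∈ ℤ: ∫_{I_i} v² dx ≤ A_i Δx^{2k+2}, sup_{I_i} v² ≤ A_i Δx^{2k+1}, and ∫_{I_i} (v')² dx ≤ A_i Δx^{2k}. Then there exists a constant c > 0, depending only on λ, such that ‖v‖²_{L²(ℝ)} + |v|²_{H^{λ/2}(ℝ)} ≤ c M Δx^{2k+2−λ}. (This is the core estimate behind the paper's projection error bound ‖u − 𝐮‖²_{H^{λ/2}(ℝ)} ≤ c_k ‖u‖²_{H^{k+1}(ℝ)} Δx^{2k+2−λ} for the L²-projection 𝐮 of u onto piecewise polynomials of degree ≤ k.) -/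
open MeasureTheory Set Filter
open scoped ENNReal NNReal

/-- The squared `L²(ℝ)` norm, as an extended nonnegative real. -/
noncomputable def L2sqE (φ : ℝ → ℝ) : ℝ≥0∞ :=
  ∫⁻ x : ℝ, ENNReal.ofReal ((φ x) ^ 2)

/-- The squared Gagliardo seminorm `|u|²_{H^{λ/2}(ℝ)}`, as an extended nonnegative real. -/
noncomputable def gagSqE (lam : ℝ) (u : ℝ → ℝ) : ℝ≥0∞ :=
  ∫⁻ x : ℝ, ∫⁻ z : ℝ, ENNReal.ofReal ((u z - u x) ^ 2 / |z - x| ^ (1 + lam))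

theorem lintegral_eq_tsum_cells {dx : ℝ} (hdx : 0 < dx) (F : ℝ → ℝ≥0∞) :
    ∫⁻ x, F x = ∑' i : ℤ, ∫⁻ x in Ioo ((i : ℝ) * dx) (((i : ℝ) + 1) * dx), F x := by
  have h1 : (⋃ i : ℤ, Ico ((i : ℝ) * dx) (((i : ℝ) + 1) * dx)) = univ := by
    simpa using iUnion_Ico_zsmul hdx
  have h2 : Pairwise (Function.onFun Disjoint
      fun i : ℤ => Ico ((i : ℝ) * dx) (((i : ℝ) + 1) * dx)) := by
    simpa using pairwise_disjoint_Ico_zsmul dx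
  rw [← setLIntegral_univ, ← h1, lintegral_iUnion (fun i => measurableSet_Ico) h2]
  exact tsum_congr fun i => (setLIntegral_congr Ioo_ae_eq_Ico).symm

theorem floor_div_eq_iff_mem_Ico {dx : ℝ} (hdx : 0 < dx) (x : ℝ) (i : ℤ) :
    ⌊x / dx⌋ = i ↔ x ∈ Ico ((i : ℝ) * dx) (((i : ℝ) + 1) * dx) := by
  rw [Int.floor_eq_iff, le_div_iff₀ hdx, div_lt_iff₀ hdx, mem_Ico]

theorem setLIntegral_Ioo_sub_left (g : ℝ → ℝ≥0∞) (a b : ℝ) :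
    ∫⁻ z in Ioo a b, g (z - a) = ∫⁻ t in Ioo 0 (b - a), g t := by
  rw [← lintegral_indicator measurableSet_Ioo, ← lintegral_indicator measurableSet_Ioo]
  refine Eq.trans (lintegral_congr fun z => ?_) (lintegral_sub_right_eq_self _ a)
  simp [indicator, sub_pos]

theorem setLIntegral_Ioo_sub_right (g : ℝ → ℝ≥0∞) (a b : ℝ) :
    ∫⁻ z in Ioo a b, g (b - z) = ∫⁻ t in Ioo 0 (b - a), g t := by
  rw [← lintegral_indicator measurableSet_Ioo, ← lintegral_indicator measurableSet_Ioo]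
  refine Eq.trans (lintegral_congr fun z => ?_) (lintegral_sub_left_eq_self _ b)
  simp [indicator, sub_pos, and_comm]

theorem setLIntegral_Ioi_sub (g : ℝ → ℝ≥0∞) (b x : ℝ) :
    ∫⁻ z in Ioi b, g (z - x) = ∫⁻ t in Ioi (b - x), g t := by
  rw [← lintegral_indicator measurableSet_Ioi, ← lintegral_indicator measurableSet_Ioi]
  refine Eq.trans (lintegral_congr fun z => ?_) (lintegral_sub_right_eq_self _ x)
  simp [indicator]

theorem setLIntegral_Iio_sub (g : ℝ → ℝ≥0∞) (a x : ℝ) :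
    ∫⁻ z in Iio a, g (x - z) = ∫⁻ t in Ioi (x - a), g t := by
  rw [← lintegral_indicator measurableSet_Iio, ← lintegral_indicator measurableSet_Ioi]
  refine Eq.trans (lintegral_congr fun z => ?_) (lintegral_sub_left_eq_self _ x)
  simp [indicator]

theorem setLIntegral_Ioo_rpow_neg {lam L : ℝ} (hlam : lam < 1) (hL : 0 ≤ L) :
    ∫⁻ t in Ioo 0 L, ENNReal.ofReal (t ^ (-lam)) = ENNReal.ofReal (L ^ (1 - lam) / (1 - lam)) := by
  have hi : IntervalIntegrable (fun t : ℝ => t ^ (-lam)) volume 0 L :=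
    intervalIntegral.intervalIntegrable_rpow' (by linarith)
  rw [setLIntegral_congr Ioo_ae_eq_Ioc, ← ofReal_integral_eq_lintegral_ofReal
    ((intervalIntegrable_iff_integrableOn_Ioc_of_le hL).1 hi)
    ((ae_restrict_mem measurableSet_Ioc).mono fun t ht => Real.rpow_nonneg ht.1.le _),
    ← intervalIntegral.integral_of_le hL, integral_rpow (Or.inl (by linarith)),
    Real.zero_rpow (by linarith), sub_zero, neg_add_eq_sub]

theorem setLIntegral_Ioi_rpow_neg {lam d : ℝ} (hlam : 0 < lam) (hd : 0 < d) :
    ∫⁻ t in Ioi d, ENNReal.ofReal (t ^ (-(1 + lam))) = ENNReal.ofReal (d ^ (-lam) / lam) := by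
  have h : -(1 + lam) < -1 := by linarith
  rw [← ofReal_integral_eq_lintegral_ofReal (integrableOn_Ioi_rpow_of_lt h hd)
    ((ae_restrict_mem measurableSet_Ioi).mono fun t ht => Real.rpow_nonneg (hd.trans ht).le _),
    integral_Ioi_rpow_of_lt h hd]
  congr 1
  rw [show -(1 + lam) + 1 = -lam by ring, neg_div_neg_eq]

theorem sq_intervalIntegral_le_mul {g : ℝ → ℝ} {x z : ℝ} (hxz : x ≤ z)
    (hg : ContinuousOn g (Icc x z)) :
    (∫ t in x..z, g t) ^ 2 ≤ (z - x) * ∫ t in x..z, (g t) ^ 2 := by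
  rcases hxz.eq_or_lt with rfl | hlt
  · simp
  have hg' : ContinuousOn g (uIcc x z) := by rwa [uIcc_of_le hxz]
  set P := ∫ t in x..z, g t
  set Q := ∫ t in x..z, (g t) ^ 2
  have hi1 : IntervalIntegrable g volume x z := hg'.intervalIntegrable
  have hi2 : IntervalIntegrable (fun t => (g t) ^ 2) volume x z := (hg'.pow 2).intervalIntegrable
  have h0 : 0 ≤ ∫ t in x..z, ((z - x) * g t - P) ^ 2 :=
    intervalIntegral.integral_nonneg hxz fun t _ => sq_nonneg _
  have h1 : ∫ t in x..z, ((z - x) * g t - P) ^ 2 =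
      (z - x) ^ 2 * Q - 2 * (z - x) * P * P + (z - x) * P ^ 2 := by
    have : (fun t => ((z - x) * g t - P) ^ 2) =
        fun t => (z - x) ^ 2 * (g t) ^ 2 - 2 * (z - x) * P * g t + P ^ 2 := by
      funext t; ring
    rw [this, intervalIntegral.integral_add ((hi2.const_mul _).sub (hi1.const_mul _))
      intervalIntegrable_const, intervalIntegral.integral_sub (hi2.const_mul _) (hi1.const_mul _),
      intervalIntegral.integral_const_mul, intervalIntegral.integral_const_mul,
      intervalIntegral.integral_const, smul_eq_mul]
  have h2 : 0 ≤ (z - x) * ((z - x) * Q - P ^ 2) := by rw [h1] at h0; linarith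
  have := nonneg_of_mul_nonneg_right h2 (sub_pos.2 hlt)
  linarith

theorem sq_sub_le_mul_integral_deriv_sq {v : ℝ → ℝ} {a b x z : ℝ}
    (hv : ContDiffOn ℝ 1 v (Ioo a b)) (hi : IntegrableOn (fun t => (deriv v t) ^ 2) (Ioo a b))
    (hx : x ∈ Ioo a b) (hz : z ∈ Ioo a b) :
    (v z - v x) ^ 2 ≤ |z - x| * ∫ t in Ioo a b, (deriv v t) ^ 2 := by
  wlog hxz : x ≤ z generalizing x z
  · rw [abs_sub_comm, ← neg_sub (v x) (v z), neg_sq]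
    exact this hz hx (le_of_not_ge hxz)
  have hsub : Icc x z ⊆ Ioo a b := fun t ht => ⟨hx.1.trans_le ht.1, ht.2.trans_lt hz.2⟩
  have hc : ContinuousOn (deriv v) (Icc x z) :=
    (hv.continuousOn_deriv_of_isOpen isOpen_Ioo le_rfl).mono hsub
  have hFTC : ∫ t in x..z, deriv v t = v z - v x := by
    refine intervalIntegral.integral_deriv_eq_sub (fun t ht => ?_) ?_
    · rw [uIcc_of_le hxz] at ht
      exact (hv.differentiableOn one_ne_zero).differentiableAt (Ioo_mem_nhds (hsub ht).1 (hsub ht).2)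
    · exact ContinuousOn.intervalIntegrable (by rwa [uIcc_of_le hxz])
  rw [← hFTC, abs_of_nonneg (sub_nonneg.2 hxz)]
  refine (sq_intervalIntegral_le_mul hxz hc).trans ?_
  refine mul_le_mul_of_nonneg_left ?_ (sub_nonneg.2 hxz)
  rw [intervalIntegral.integral_of_le hxz]
  exact setIntegral_mono_set hi (ae_of_all _ fun t => sq_nonneg _)
    (Ioc_subset_Icc_self.trans hsub).eventuallyLE

theorem setLIntegral_Ioo_abs_rpow_neg_le {lam a b x : ℝ} (hlam : lam < 1) (hx : x ∈ Ioo a b) :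
    ∫⁻ z in Ioo a b, ENNReal.ofReal (|z - x| ^ (-lam)) ≤
      ENNReal.ofReal (2 * ((b - a) ^ (1 - lam) / (1 - lam))) := by
  have h1 : ∫⁻ z in Ioo a x, ENNReal.ofReal (|z - x| ^ (-lam)) ≤
      ENNReal.ofReal ((b - a) ^ (1 - lam) / (1 - lam)) := by
    rw [setLIntegral_congr_fun measurableSet_Ioo (g := fun z => ENNReal.ofReal ((x - z) ^ (-lam)))
      fun z hz => by simp only [abs_sub_comm z x, abs_of_pos (sub_pos.2 hz.2)],
      setLIntegral_Ioo_sub_right (fun t => ENNReal.ofReal (t ^ (-lam))),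
      setLIntegral_Ioo_rpow_neg hlam (sub_nonneg.2 hx.1.le)]
    have := hx.1; have := hx.2
    gcongr
  have h2 : ∫⁻ z in Ioo x b, ENNReal.ofReal (|z - x| ^ (-lam)) ≤
      ENNReal.ofReal ((b - a) ^ (1 - lam) / (1 - lam)) := by
    rw [setLIntegral_congr_fun measurableSet_Ioo (g := fun z => ENNReal.ofReal ((z - x) ^ (-lam)))
      fun z hz => by simp only [abs_of_pos (sub_pos.2 hz.1)],
      setLIntegral_Ioo_sub_left (fun t => ENNReal.ofReal (t ^ (-lam))),
      setLIntegral_Ioo_rpow_neg hlam (sub_nonneg.2 hx.2.le)]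
    have := hx.1; have := hx.2
    gcongr
  have h0 : 0 ≤ (b - a) ^ (1 - lam) / (1 - lam) :=
    div_nonneg (Real.rpow_nonneg (by linarith [hx.1, hx.2]) _) (by linarith)
  rw [two_mul, ENNReal.ofReal_add h0 h0, ← Ioc_union_Ioo_eq_Ioo hx.1.le hx.2]
  refine (lintegral_union_le _ _ _).trans (add_le_add ?_ h2)
  rwa [← setLIntegral_congr Ioo_ae_eq_Ioc]

theorem setLIntegral_compl_Ico_abs_rpow_le {lam a b x : ℝ} (hlam : 0 < lam) (hx : x ∈ Ioo a b) :
    ∫⁻ z in (Ico a b)ᶜ, ENNReal.ofReal (|z - x| ^ (-(1 + lam))) ≤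
      ENNReal.ofReal ((x - a) ^ (-lam) / lam) + ENNReal.ofReal ((b - x) ^ (-lam) / lam) := by
  have hc : (Ico a b)ᶜ = Iio a ∪ Ici b := by
    ext z; simp only [mem_compl_iff, mem_Ico, mem_union, mem_Iio, mem_Ici]; grind
  rw [hc]
  refine (lintegral_union_le _ _ _).trans (add_le_add (le_of_eq ?_) (le_of_eq ?_))
  · rw [← setLIntegral_Ioi_rpow_neg hlam (sub_pos.2 hx.1), ← setLIntegral_Iio_sub]
    refine setLIntegral_congr_fun measurableSet_Iio fun z hz => ?_
    simp only [abs_sub_comm z x, abs_of_pos (sub_pos.2 (lt_trans hz hx.1))]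
  · rw [← setLIntegral_Ioi_rpow_neg hlam (sub_pos.2 hx.2), ← setLIntegral_Ioi_sub,
      setLIntegral_congr Ioi_ae_eq_Ici]
    refine setLIntegral_congr_fun measurableSet_Ici fun z hz => ?_
    simp only [abs_of_pos (sub_pos.2 (lt_of_lt_of_le hx.2 hz))]

theorem setLIntegral_Ioo_same_cell_le {lam a b E : ℝ} (hlam : lam < 1) (hab : a ≤ b) (hE : 0 ≤ E)
    {v : ℝ → ℝ}
    (hv : ∀ x ∈ Ioo a b, ∀ z ∈ Ioo a b, (v z - v x) ^ 2 ≤ |z - x| * E) :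
    ∫⁻ x in Ioo a b, ∫⁻ z in Ioo a b, ENNReal.ofReal ((v z - v x) ^ 2 / |z - x| ^ (1 + lam)) ≤
      ENNReal.ofReal (E * (2 * ((b - a) ^ (1 - lam) / (1 - lam))) * (b - a)) := by
  have h0 : 0 ≤ (b - a) ^ (1 - lam) / (1 - lam) :=
    div_nonneg (Real.rpow_nonneg (by linarith) _) (by linarith)
  calc _ ≤ ∫⁻ x in Ioo a b, ENNReal.ofReal (E * (2 * ((b - a) ^ (1 - lam) / (1 - lam)))) := by
        refine setLIntegral_mono' measurableSet_Ioo fun x hx => ?_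
        rw [ENNReal.ofReal_mul hE]
        refine le_trans ?_ (mul_le_mul_right (setLIntegral_Ioo_abs_rpow_neg_le hlam hx) _)
        rw [← lintegral_const_mul' _ _ ENNReal.ofReal_ne_top]
        refine setLIntegral_mono' measurableSet_Ioo fun z hz => ?_
        rw [← ENNReal.ofReal_mul hE]
        refine ENNReal.ofReal_le_ofReal ?_
        rcases eq_or_ne z x with rfl | hne
        · simpa using mul_nonneg hE (Real.rpow_nonneg le_rfl _)
        have hp : 0 < |z - x| := abs_pos.2 (sub_ne_zero.2 hne)
        rw [div_le_iff₀ (Real.rpow_pos_of_pos hp _), mul_assoc, ← Real.rpow_add hp,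
          show -lam + (1 + lam) = 1 by ring, Real.rpow_one, mul_comm]
        exact hv x hx z hz
    _ = _ := by
        rw [setLIntegral_const, Real.volume_Ioo, ← ENNReal.ofReal_mul (by positivity)]

theorem setLIntegral_Ioo_other_cells_le {lam a b B : ℝ} (hlam : lam ∈ Ioo (0 : ℝ) 1)
    (hab : a ≤ b) (hB : 0 ≤ B) {V : ℝ → ℝ} (hV : ∀ x ∈ Ioo a b, V x ≤ B) :
    ∫⁻ x in Ioo a b, ENNReal.ofReal (V x) *
        ∫⁻ z in (Ico a b)ᶜ, ENNReal.ofReal (|z - x| ^ (-(1 + lam))) ≤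
      ENNReal.ofReal (B / lam * (2 * ((b - a) ^ (1 - lam) / (1 - lam)))) := by
  have hl := hlam.1
  have h0 : 0 ≤ (b - a) ^ (1 - lam) / (1 - lam) :=
    div_nonneg (Real.rpow_nonneg (by linarith) _) (by linarith [hlam.2])
  calc _ ≤ ∫⁻ x in Ioo a b, ENNReal.ofReal (B / lam) *
          (ENNReal.ofReal ((x - a) ^ (-lam)) + ENNReal.ofReal ((b - x) ^ (-lam))) := by
        refine setLIntegral_mono' measurableSet_Ioo fun x hx => ?_
        refine (mul_le_mul' (ENNReal.ofReal_le_ofReal (hV x hx))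
          (setLIntegral_compl_Ico_abs_rpow_le hl hx)).trans (le_of_eq ?_)
        rw [mul_add, mul_add, ← ENNReal.ofReal_mul hB, ← ENNReal.ofReal_mul hB,
          ← ENNReal.ofReal_mul (by positivity), ← ENNReal.ofReal_mul (by positivity)]
        congr 2 <;> ring
    _ = _ := by
        rw [lintegral_const_mul' _ _ ENNReal.ofReal_ne_top, lintegral_add_left (by fun_prop),
          setLIntegral_Ioo_sub_left (fun t => ENNReal.ofReal (t ^ (-lam))),
          setLIntegral_Ioo_sub_right (fun t => ENNReal.ofReal (t ^ (-lam))),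
          setLIntegral_Ioo_rpow_neg hlam.2 (sub_nonneg.2 hab), ← ENNReal.ofReal_add h0 h0,
          ← two_mul, ← ENNReal.ofReal_mul (by positivity)]

theorem gagSqE_le_tsum_cells {lam dx : ℝ} (hdx : 0 < dx) {v : ℝ → ℝ} (hv : Measurable v) :
    gagSqE lam v ≤ ∑' i : ℤ,
      ((∫⁻ x in Ioo ((i : ℝ) * dx) (((i : ℝ) + 1) * dx),
          ∫⁻ z in Ioo ((i : ℝ) * dx) (((i : ℝ) + 1) * dx),
            ENNReal.ofReal ((v z - v x) ^ 2 / |z - x| ^ (1 + lam))) +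
        2 * ∫⁻ x in Ioo ((i : ℝ) * dx) (((i : ℝ) + 1) * dx), ENNReal.ofReal (2 * (v x) ^ 2) *
          ∫⁻ z in (Ico ((i : ℝ) * dx) (((i : ℝ) + 1) * dx))ᶜ,
            ENNReal.ofReal (|z - x| ^ (-(1 + lam)))) := by
  set f : ℝ → ℝ → ℝ≥0∞ := fun x z =>
    ENNReal.ofReal ((v z - v x) ^ 2 / |z - x| ^ (1 + lam)) with hf
  set V : ℝ → ℝ≥0∞ := fun x => ENNReal.ofReal (2 * (v x) ^ 2)
  set D : ℝ → ℝ → ℝ≥0∞ := fun x z => if ⌊z / dx⌋ = ⌊x / dx⌋ then f x z else 0 with hD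
  set N : ℝ → ℝ → ℝ≥0∞ := fun x z => if ⌊z / dx⌋ = ⌊x / dx⌋ then 0 else
    ENNReal.ofReal (|z - x| ^ (-(1 + lam))) with hN
  have hVm : Measurable V := by fun_prop
  have hset : MeasurableSet {p : ℝ × ℝ | ⌊p.2 / dx⌋ = ⌊p.1 / dx⌋} :=
    measurableSet_eq_fun (Int.measurable_floor.comp (measurable_snd.div_const _))
      (Int.measurable_floor.comp (measurable_fst.div_const _))
  have hfm : Measurable fun p : ℝ × ℝ => f p.1 p.2 := by fun_prop
  have hDm : Measurable fun p : ℝ × ℝ => D p.1 p.2 :=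
    Measurable.ite hset hfm measurable_const
  have hNm : Measurable fun p : ℝ × ℝ => N p.1 p.2 :=
    Measurable.ite hset measurable_const (by fun_prop)
  have hNsymm : ∀ x z, N x z = N z x := fun x z => by
    simp only [hN, abs_sub_comm z x, eq_comm (a := ⌊z / dx⌋)]
  have hNx : ∀ x, Measurable (N x) := fun x => hNm.comp measurable_prodMk_left
  have hDx : ∀ x, Measurable (D x) := fun x => hDm.comp measurable_prodMk_left
  have hle : ∀ x z, f x z ≤ D x z + (V x * N x z + V z * N x z) := fun x z => by
    simp only [hD, hN]
    split_ifs with h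
    · simp
    · rw [zero_add, ← add_mul, ← ENNReal.ofReal_add (by positivity) (by positivity),
        ← ENNReal.ofReal_mul (by positivity)]
      refine ENNReal.ofReal_le_ofReal ?_
      rw [Real.rpow_neg (abs_nonneg _), ← div_eq_mul_inv]
      gcongr
      nlinarith [sq_nonneg (v z + v x)]
  have hswap : ∫⁻ x, ∫⁻ z, V z * N x z = ∫⁻ x, V x * ∫⁻ z, N x z := by
    rw [lintegral_lintegral_swap ((hVm.comp measurable_snd).mul hNm).aemeasurable]
    refine lintegral_congr fun z => ?_
    rw [← lintegral_const_mul _ (hNx z)]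
    exact lintegral_congr fun x => by rw [hNsymm]
  calc gagSqE lam v ≤ ∫⁻ x, ∫⁻ z, (D x z + (V x * N x z + V z * N x z)) :=
        lintegral_mono fun x => lintegral_mono fun z => hle x z
    _ = ∫⁻ x, ((∫⁻ z, D x z) + ((V x * ∫⁻ z, N x z) + ∫⁻ z, V z * N x z)) := by
        refine lintegral_congr fun x => ?_
        rw [lintegral_add_left (hDx x), lintegral_add_left ((hNx x).const_mul _),
          lintegral_const_mul _ (hNx x)]
    _ = ∫⁻ x, ((∫⁻ z, D x z) + 2 * (V x * ∫⁻ z, N x z)) := by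
        have hm1 : Measurable fun x => ∫⁻ z, D x z := hDm.lintegral_prod_right'
        have hm2 : Measurable fun x => V x * ∫⁻ z, N x z := hVm.mul hNm.lintegral_prod_right'
        rw [lintegral_add_left hm1, lintegral_add_left hm2, hswap, ← two_mul,
          lintegral_add_left hm1, lintegral_const_mul _ hm2]
    _ = _ := by
        rw [lintegral_eq_tsum_cells hdx]
        refine tsum_congr fun i => ?_
        have hm1 : Measurable fun x => ∫⁻ z, D x z := hDm.lintegral_prod_right'
        have hm2 : Measurable fun x => V x * ∫⁻ z, N x z := hVm.mul hNm.lintegral_prod_right'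
        rw [lintegral_add_left hm1, lintegral_const_mul _ hm2]
        congr 1
        · refine setLIntegral_congr_fun measurableSet_Ioo fun x hx => ?_
          have hxi := (floor_div_eq_iff_mem_Ico hdx x i).2 (Ioo_subset_Ico_self hx)
          rw [setLIntegral_congr Ioo_ae_eq_Ico, ← lintegral_indicator measurableSet_Ico]
          refine lintegral_congr fun z => ?_
          simp only [hD, hf, hxi, floor_div_eq_iff_mem_Ico hdx, indicator]
        · congr 1
          refine setLIntegral_congr_fun measurableSet_Ioo fun x hx => ?_
          have hxi := (floor_div_eq_iff_mem_Ico hdx x i).2 (Ioo_subset_Ico_self hx)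
          rw [← lintegral_indicator measurableSet_Ico.compl]
          congr 1
          refine lintegral_congr fun z => ?_
          simp only [hN, hxi, floor_div_eq_iff_mem_Ico hdx, indicator, mem_compl_iff, ite_not]

/-- Core estimate behind Lemma A.5 (projection error bound):
cellwise `L²`, `L^∞` and `H¹` bounds of orders `Δx^{2k+2}`, `Δx^{2k+1}`, `Δx^{2k}` imply
`‖v‖²_{L²} + |v|²_{H^{λ/2}} ≤ c M Δx^{2k+2−λ}`, with `c` depending only on `λ`. -/
theorem stmt_8 (lam : ℝ) (hlam : lam ∈ Set.Ioo (0 : ℝ) 1) (k : ℕ) :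
    ∃ c > (0 : ℝ), ∀ dx ∈ Set.Ioc (0 : ℝ) 1, ∀ v : ℝ → ℝ,
      Measurable v →
      (∀ i : ℤ, ContDiffOn ℝ 1 v (Set.Ioo ((i : ℝ) * dx) (((i : ℝ) + 1) * dx))) →
      ∀ A : ℤ → ℝ, (∀ i, 0 ≤ A i) → Summable A →
      (∀ i : ℤ,
        (IntegrableOn (fun x => (v x) ^ 2) (Set.Ioo ((i : ℝ) * dx) (((i : ℝ) + 1) * dx)) ∧
          (∫ x in Set.Ioo ((i : ℝ) * dx) (((i : ℝ) + 1) * dx), (v x) ^ 2) ≤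
            A i * dx ^ (2 * k + 2)) ∧
        (∀ x ∈ Set.Ioo ((i : ℝ) * dx) (((i : ℝ) + 1) * dx),
          (v x) ^ 2 ≤ A i * dx ^ (2 * k + 1)) ∧
        (IntegrableOn (fun x => (deriv v x) ^ 2)
            (Set.Ioo ((i : ℝ) * dx) (((i : ℝ) + 1) * dx)) ∧
          (∫ x in Set.Ioo ((i : ℝ) * dx) (((i : ℝ) + 1) * dx), (deriv v x) ^ 2) ≤
            A i * dx ^ (2 * k))) →
      L2sqE v + gagSqE lam v ≤
        ENNReal.ofReal (c * (∑' i : ℤ, A i) * dx ^ (2 * (k : ℝ) + 2 - lam)) := by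
  obtain ⟨hl0, hl1⟩ := hlam
  have hl1' : 0 < 1 - lam := by linarith
  refine ⟨1 + (2 / (1 - lam) + 8 / (lam * (1 - lam))), by positivity, ?_⟩
  rintro dx ⟨hdx, hdx1⟩ v hv hC A hA hAs h
  set p : ℝ := dx ^ (2 * (k : ℝ) + 2 - lam) with hp
  have hp0 : 0 ≤ p := Real.rpow_nonneg hdx.le _
  have hpow : dx ^ (2 * k + 1) * dx ^ (1 - lam) = p := by
    rw [← Real.rpow_natCast, ← Real.rpow_add hdx, hp]
    congr 1; push_cast; ring
  have hpow' : dx ^ (2 * k) * dx ^ (1 - lam) * dx = p := by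
    rw [← hpow]; ring
  have hpow2 : dx ^ (2 * k + 2) ≤ p := by
    rw [← Real.rpow_natCast, hp]
    refine Real.rpow_le_rpow_of_exponent_ge hdx hdx1 ?_
    push_cast; linarith
  have hcell : ∀ i : ℤ, ((i : ℝ) + 1) * dx - (i : ℝ) * dx = dx := fun i => by ring
  have hcell' : ∀ i : ℤ, (i : ℝ) * dx ≤ ((i : ℝ) + 1) * dx := fun i => by nlinarith
  refine (add_le_add (le_of_eq (lintegral_eq_tsum_cells hdx _))
    (gagSqE_le_tsum_cells hdx hv)).trans ?_
  rw [← ENNReal.tsum_add, show (1 + (2 / (1 - lam) + 8 / (lam * (1 - lam)))) * (∑' i, A i) * p =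
    ∑' i, (1 + (2 / (1 - lam) + 8 / (lam * (1 - lam)))) * p * A i by rw [tsum_mul_left]; ring,
    ENNReal.ofReal_tsum_of_nonneg (fun i => mul_nonneg (by positivity) (hA i)) (hAs.mul_left _)]
  refine ENNReal.tsum_le_tsum fun i => ?_
  obtain ⟨⟨hint, hL2⟩, hsup, hdint, hH1⟩ := h i
  have hAi := hA i
  rw [show (1 + (2 / (1 - lam) + 8 / (lam * (1 - lam)))) * p * A i =
      A i * p + (A i * (2 / (1 - lam)) * p + A i * (8 / (lam * (1 - lam))) * p) by ring,
    ENNReal.ofReal_add (by positivity) (by positivity),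
    ENNReal.ofReal_add (by positivity) (by positivity)]
  refine add_le_add ?_ (add_le_add ?_ ?_)
  · rw [← ofReal_integral_eq_lintegral_ofReal hint (ae_of_all _ fun x => sq_nonneg _)]
    exact ENNReal.ofReal_le_ofReal (hL2.trans (mul_le_mul_of_nonneg_left hpow2 hAi))
  · refine (setLIntegral_Ioo_same_cell_le (E := A i * dx ^ (2 * k)) hl1 (hcell' i) (by positivity)
      fun x hx z hz => (sq_sub_le_mul_integral_deriv_sq (hC i) hdint hx hz).trans
        (mul_le_mul_of_nonneg_left hH1 (abs_nonneg _))).trans (le_of_eq ?_)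
    rw [hcell, ← hpow']
    congr 1; ring
  · refine (mul_le_mul_right (setLIntegral_Ioo_other_cells_le (B := 2 * (A i * dx ^ (2 * k + 1)))
      ⟨hl0, hl1⟩ (hcell' i) (by positivity)
      fun x hx => mul_le_mul_of_nonneg_left (hsup x hx) zero_le_two) 2).trans (le_of_eq ?_)
    rw [hcell, ← hpow, show (2 : ℝ≥0∞) = ENNReal.ofReal 2 by simp, ← ENNReal.ofReal_mul zero_le_two]
    congr 1
    field_simp
    ring
end

section
/- Let λ ∈ (0,1), c_λ > 0, F a numerical flux satisfying (A1)–(A4) with Lipschitz constants F₁, F₂, and Δx, Δt > 0 with (F₁ + F₂)Δt/Δx ≤ 1. Suppose U, V ∈ ℓ^∞(ℤ) ∩ ℓ¹(ℤ) satisfy the implicit-explicit relation V_i = U_i − Δt D₋F(U)_i + Δt g⟨V⟩_i for all i ∈ ℤ. Then the cell entropy inequality holds: for every k ∈ ℝ and every i ∈ ℤ, |V_i − k| − |U_i − k| + (Δt/Δx)(Q_i − Q_{i−1}) − Δt·sgn(V_i − k)·g⟨V⟩_i ≤ 0, where Q_i := F(max(U_i,k), max(U_{i+1},k)) − F(min(U_i,k),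 min(U_{i+1},k)) and sgn(0) = 0. -/
open MeasureTheory Set Filter
open scoped ENNReal NNReal

/-- A numerical flux `F` for the flux `f`, satisfying (A1)-(A4). -/
def NumFlux (f : ℝ → ℝ) (F : ℝ → ℝ → ℝ) (F1 F2 : ℝ≥0) : Prop :=
  (∀ b, LipschitzWith F1 fun a => F a b) ∧ (∀ a, LipschitzWith F2 (F a)) ∧
  (∀ a, F a a = f a) ∧ (∀ b, Monotone fun a => F a b) ∧ (∀ a, Antitone (F a))

/-- Discrete flux difference `D₋F(U)_i = (F(U_i,U_{i+1}) − F(U_{i−1},U_i))/Δx`. -/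
noncomputable def DmF (F : ℝ → ℝ → ℝ) (dx : ℝ) (U : ℤ → ℝ) (i : ℤ) : ℝ :=
  (F (U i) (U (i + 1)) - F (U (i - 1)) (U i)) / dx

/-- Discrete nonlocal operator `g⟨U⟩_i = (1/Δx) Σ_j G^i_j U_j`. -/
noncomputable def gBr (lam clam dx : ℝ) (U : ℤ → ℝ) (i : ℤ) : ℝ :=
  (1 / dx) * ∑' j : ℤ, cellG lam clam dx i j * U j

/-- The explicit three-point update `H(a,b,c) = b - r (F(b,c) - F(a,b))` is monotone in all of
its arguments under the CFL condition `r (F₁ + F₂) ≤ 1`. -/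
theorem NumFlux.update_mono {f : ℝ → ℝ} {F : ℝ → ℝ → ℝ} {F1 F2 : ℝ≥0}
    (h : NumFlux f F F1 F2) {r : ℝ} (hr : 0 ≤ r) (hCFL : r * ((F1 : ℝ) + F2) ≤ 1)
    {a a' b b' c c' : ℝ} (ha : a ≤ a') (hb : b ≤ b') (hc : c ≤ c') :
    b - r * (F b c - F a b) ≤ b' - r * (F b' c' - F a' b') := by
  obtain ⟨h1, h2, -, hmono, hanti⟩ := h
  have e1 : F b' c - F b c ≤ F1 * (b' - b) := by
    have := (h1 c).dist_le_mul b' b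
    rw [Real.dist_eq, Real.dist_eq, abs_of_nonneg (sub_nonneg.2 hb)] at this
    exact (le_abs_self _).trans this
  have e2 : F a b - F a b' ≤ F2 * (b' - b) := by
    have := (h2 a).dist_le_mul b b'
    rw [Real.dist_eq, Real.dist_eq, abs_sub_comm b b', abs_of_nonneg (sub_nonneg.2 hb)] at this
    exact (le_abs_self _).trans this
  have e3 : F b' c' ≤ F b' c := hanti b' hc
  have e4 : F a b' ≤ F a' b' := hmono b' ha
  have e5 : (F b' c' - F a' b') - (F b c - F a b) ≤ (F1 + F2) * (b' - b) := by linarith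
  have e6 := mul_le_mul_of_nonneg_left e5 hr
  have e7 := mul_le_mul_of_nonneg_right hCFL (sub_nonneg.2 hb)
  linarith

/-- Crandall–Majda entropy inequality for the explicit three-point update. -/
theorem NumFlux.abs_update_sub_le {f : ℝ → ℝ} {F : ℝ → ℝ → ℝ} {F1 F2 : ℝ≥0}
    (h : NumFlux f F F1 F2) {r : ℝ} (hr : 0 ≤ r) (hCFL : r * ((F1 : ℝ) + F2) ≤ 1)
    (a b c k : ℝ) :
    |b - r * (F b c - F a b) - k| ≤ |b - k| -
      r * ((F (max b k) (max c k) - F (min b k) (min c k)) -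
        (F (max a k) (max b k) - F (min a k) (min b k))) := by
  have u1 := h.update_mono hr hCFL (le_max_left a k) (le_max_left b k) (le_max_left c k)
  have u2 := h.update_mono hr hCFL (le_max_right a k) (le_max_right b k) (le_max_right c k)
  have l1 := h.update_mono hr hCFL (min_le_left a k) (min_le_left b k) (min_le_left c k)
  have l2 := h.update_mono hr hCFL (min_le_right a k) (min_le_right b k) (min_le_right c k)
  have habs := max_sub_min_eq_abs' b k
  rw [abs_le]
  constructor <;> linarith

/-- For every `w`, `|v - k| - sgn(v - k) (v - w) = sgn(v - k) (w - k) ≤ |w - k|`. -/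
theorem abs_sub_sub_sign_mul_le (v w k : ℝ) :
    |v - k| - Real.sign (v - k) * (v - w) ≤ |w - k| := by
  rcases lt_trichotomy (v - k) 0 with hv | hv | hv
  · rw [Real.sign_of_neg hv, abs_of_neg hv]
    linarith [neg_le_abs (w - k)]
  · simp [hv]
  · rw [Real.sign_of_pos hv, abs_of_pos hv]
    linarith [le_abs_self (w - k)]

/-- Cell entropy inequality (4.10) for the implicit-explicit step: for all `k` and `i`,
`|V_i − k| − |U_i − k| + (Δt/Δx)(Q_i − Q_{i−1}) − Δt·sgn(V_i − k)·g⟨V⟩_i ≤ 0`. -/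
theorem stmt_13 (lam clam dx dt : ℝ) (hlam : lam ∈ Set.Ioo (0 : ℝ) 1) (hclam : 0 < clam)
    (hdx : 0 < dx) (hdt : 0 < dt)
    (f : ℝ → ℝ) (Lf : ℝ≥0) (hf : LipschitzWith Lf f)
    (F : ℝ → ℝ → ℝ) (F1 F2 : ℝ≥0) (hflux : NumFlux f F F1 F2)
    (hCFL : ((F1 : ℝ) + (F2 : ℝ)) * dt / dx ≤ 1)
    (U V : ℤ → ℝ)
    (hU1 : Summable fun i => |U i|) (hUinf : ∃ M : ℝ, ∀ i, |U i| ≤ M)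
    (hV1 : Summable fun i => |V i|) (hVinf : ∃ M : ℝ, ∀ i, |V i| ≤ M)
    (hrel : ∀ i : ℤ, V i = U i - dt * DmF F dx U i + dt * gBr lam clam dx V i) :
    ∀ k : ℝ, ∀ i : ℤ,
      |V i - k| - |U i - k| +
        (dt / dx) *
          ((F (max (U i) k) (max (U (i + 1)) k) - F (min (U i) k) (min (U (i + 1)) k)) -
            (F (max (U (i - 1)) k) (max (U i) k) - F (min (U (i - 1)) k) (min (U i) k))) -
        dt * Real.sign (V i - k) * gBr lam clam dx V i ≤ 0 := by
  intro k i
  have hr : 0 ≤ dt / dx := (div_pos hdt hdx).le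
  have hCFL' : dt / dx * ((F1 : ℝ) + F2) ≤ 1 := by
    rwa [div_mul_eq_mul_div, mul_comm dt]
  have hexp := hflux.abs_update_sub_le hr hCFL' (U (i - 1)) (U i) (U (i + 1)) k
  have himp := abs_sub_sub_sign_mul_le (V i)
    (U i - dt / dx * (F (U i) (U (i + 1)) - F (U (i - 1)) (U i))) k
  have hV : V i - (U i - dt / dx * (F (U i) (U (i + 1)) - F (U (i - 1)) (U i))) =
      dt * gBr lam clam dx V i := by
    have := hrel i
    rw [DmF, mul_div_assoc', ← div_mul_eq_mul_div] at this
    linarith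
  rw [hV] at himp
  linarith
end
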